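/- arXiv:1711.06749 — 2 statements merged into one kernel-verified Lean document; each statement's English description precedes it below -/
import Mathlib

section
/- Every homeomorphism h of the Golomb space satisfies h(1) = 1. -/
/-- The base of the Golomb topology: arithmetic progressions `{a + b*n : n ≥ 0}`
with coprime `a, b ≥ 1`, viewed inside the positive integers. -/
def golombBasis : Set (Set ℕ+) :=
  {S | ∃ a b : ℕ, 1 ≤ a ∧ 1 ≤ b ∧ Nat.Coprime a b ∧
    S = {x : ℕ+ | ∃ n : ℕ, (x : ℕ) = a + b * n}}

/-- The Golomb (relatively prime integer) topology on `ℕ+`. -/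
instance golombTopology : TopologicalSpace ℕ+ :=
  TopologicalSpace.generateFrom golombBasis

/-- Arithmetic progression starting at `a` with step `b`. -/
def golProg (a : ℕ+) (b : ℕ) : Set ℕ+ := {x : ℕ+ | ∃ n : ℕ, (x : ℕ) = a + b * n}

theorem golProg_open (a : ℕ+) (b : ℕ) (hb : 1 ≤ b) (hab : Nat.Coprime a b) :
    @IsOpen ℕ+ golombTopology (golProg a b) :=
  TopologicalSpace.isOpen_generateFrom_of_mem ⟨a, b, a.pos, hb, hab, rfl⟩

theorem golProg_self (a : ℕ+) (b : ℕ) : a ∈ golProg a b := ⟨0, by simp⟩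

theorem golProg_nhds (U : Set ℕ+) (hU : @IsOpen ℕ+ golombTopology U) (x : ℕ+) (hx : x ∈ U) :
    ∃ b : ℕ, 1 ≤ b ∧ Nat.Coprime x b ∧ golProg x b ⊆ U := by
  have hU' : TopologicalSpace.GenerateOpen golombBasis U := hU
  clear hU
  induction hU' with
  | basic s hs =>
    obtain ⟨a, b, ha, hb, hab, rfl⟩ := hs
    obtain ⟨n, hn⟩ := hx
    refine ⟨b, hb, ?_, ?_⟩
    · rw [hn]; simpa using hab
    · rintro y ⟨m, hm⟩
      exact ⟨n + m, by rw [hm, hn]; ring⟩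
  | univ => exact ⟨1, le_refl _, by simp, by simp⟩
  | inter s t _ _ hs ht =>
    obtain ⟨b, hb, hb2, hb3⟩ := hs hx.1
    obtain ⟨c, hc, hc2, hc3⟩ := ht hx.2
    refine ⟨b * c, Nat.mul_pos hb hc, hb2.mul_right hc2, ?_⟩
    rintro y ⟨m, hm⟩
    exact ⟨hb3 ⟨c * m, by rw [hm]; ring⟩, hc3 ⟨b * m, by rw [hm]; ring⟩⟩
  | sUnion S _ ih =>
    obtain ⟨s, hs, hxs⟩ := hx
    obtain ⟨b, hb, hb2, hb3⟩ := ih s hs hxs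
    exact ⟨b, hb, hb2, hb3.trans (Set.subset_sUnion_of_mem hs)⟩

theorem golProg_inter (a z : ℕ+) (b d : ℕ) (hb : 1 ≤ b) (hd : 1 ≤ d) :
    (golProg z d ∩ golProg a b).Nonempty ↔ (z : ℕ) ≡ a [MOD Nat.gcd d b] := by
  constructor
  · rintro ⟨y, ⟨m, hm⟩, ⟨n, hn⟩⟩
    have h1 : (z : ℕ) ≡ y [MOD Nat.gcd d b] := by
      rw [hm]
      refine (Nat.modEq_iff_dvd' (Nat.le_add_right _ _)).2 ?_
      simpa using (Nat.gcd_dvd_left d b).mul_right m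
    have h2 : (a : ℕ) ≡ y [MOD Nat.gcd d b] := by
      rw [hn]
      refine (Nat.modEq_iff_dvd' (Nat.le_add_right _ _)).2 ?_
      simpa using (Nat.gcd_dvd_right d b).mul_right n
    exact h1.trans h2.symm
  · intro h
    obtain ⟨k, hk1, hk2⟩ := Nat.chineseRemainder' h
    set y := k + d * b * (z + a) with hy
    have hdb : 1 ≤ d * b := Nat.mul_pos hd hb
    have hyl : (z : ℕ) + a ≤ y := by
      have : 1 * ((z : ℕ) + a) ≤ d * b * (z + a) := Nat.mul_le_mul_right _ hdb
      omega
    have hy1 : (z : ℕ) ≡ y [MOD d] := by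
      refine hk1.symm.trans ((Nat.modEq_iff_dvd' (Nat.le_add_right _ _)).2 ?_)
      simp only [Nat.add_sub_cancel_left]
      exact ⟨b * (z + a), by ring⟩
    have hy2 : (a : ℕ) ≡ y [MOD b] := by
      refine hk2.symm.trans ((Nat.modEq_iff_dvd' (Nat.le_add_right _ _)).2 ?_)
      simp only [Nat.add_sub_cancel_left]
      exact ⟨d * (z + a), by ring⟩
    obtain ⟨m, hm⟩ := (Nat.modEq_iff_dvd' (by omega)).1 hy1
    obtain ⟨n, hn⟩ := (Nat.modEq_iff_dvd' (by omega)).1 hy2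
    have hz := z.pos
    refine ⟨⟨y, by omega⟩, ⟨m, ?_⟩, ⟨n, ?_⟩⟩
    · change y = _; omega
    · change y = _; omega

theorem golProg_closure (a z : ℕ+) (b : ℕ) (hb : 1 ≤ b) :
    z ∈ @closure ℕ+ golombTopology (golProg a b) ↔
      ∀ d : ℕ, 1 ≤ d → Nat.Coprime z d → (z : ℕ) ≡ a [MOD Nat.gcd d b] := by
  rw [@mem_closure_iff ℕ+ golombTopology]
  constructor
  · intro h d hd hzd
    exact (golProg_inter a z b d hb hd).1 (h _ (golProg_open z d hd hzd) (golProg_self z d))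
  · intro h U hU hz
    obtain ⟨d, hd, hzd, hs⟩ := golProg_nhds U hU z hz
    exact ((golProg_inter a z b d hb hd).2 (h d hd hzd)).mono
      (Set.inter_subset_inter_left _ hs)

/-- The filter of closed neighbourhoods of `x, y` is coarser than that of `x, y'`. -/
def golSub (x y y' : ℕ+) : Prop :=
  ∀ U V : Set ℕ+, @IsOpen ℕ+ golombTopology U → @IsOpen ℕ+ golombTopology V → x ∈ U → y ∈ V →
    ∃ U' V' : Set ℕ+, @IsOpen ℕ+ golombTopology U' ∧ @IsOpen ℕ+ golombTopology V' ∧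
      x ∈ U' ∧ y' ∈ V' ∧
      @closure ℕ+ golombTopology U' ∩ @closure ℕ+ golombTopology V' ⊆
        @closure ℕ+ golombTopology U ∩ @closure ℕ+ golombTopology V

theorem golSub_map (h : @Homeomorph ℕ+ ℕ+ golombTopology golombTopology) (x y y' : ℕ+)
    (H : golSub x y y') :
    golSub (h x) (h y) (h y') := by
  intro U V hU hV hx hy
  obtain ⟨U', V', hU', hV', hx', hy', hs⟩ :=
    H (h ⁻¹' U) (h ⁻¹' V) (hU.preimage h.continuous) (hV.preimage h.continuous) hx hy
  refine ⟨h '' U', h '' V', h.isOpenMap _ hU', h.isOpenMap _ hV', ⟨x, hx', rfl⟩,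
    ⟨y', hy', rfl⟩, ?_⟩
  rw [← h.image_closure, ← h.image_closure, ← Set.image_inter h.injective]
  rintro _ ⟨z, hz, rfl⟩
  have := hs hz
  rw [← h.preimage_closure, ← h.preimage_closure] at this
  exact this

theorem golSub_one (w : ℕ+) (hw : w ≠ 1) : golSub 1 w (w ^ 2) := by
  intro U V hU hV h1 hwV
  obtain ⟨b, hb, -, hbs⟩ := golProg_nhds U hU 1 h1
  obtain ⟨c, hc, hwc, hcs⟩ := golProg_nhds V hV w hwV
  set v : ℕ := ((w ^ 2 : ℕ+) : ℕ) with hv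
  have hv2 : 2 ≤ v := by
    have : (w : ℕ) ≠ 1 := fun h => hw (PNat.coe_eq_one_iff.1 h)
    have := w.pos
    rw [hv, PNat.pow_coe]
    nlinarith [show 2 ≤ (w : ℕ) by omega]
  have hcv : 1 ≤ c ^ v := Nat.pow_pos hc
  have hbc : 1 ≤ b * c ^ v := Nat.mul_pos hb hcv
  have hcop : Nat.Coprime ((w ^ 2 : ℕ+) : ℕ) (c ^ v) := by
    rw [PNat.pow_coe]; exact Nat.Coprime.pow _ _ hwc
  refine ⟨golProg 1 (b * c ^ v), golProg (w ^ 2) (c ^ v), golProg_open _ _ hbc (by simp),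
    golProg_open _ _ hcv hcop, golProg_self _ _, golProg_self _ _, ?_⟩
  rintro z ⟨hz1, hz2⟩
  rw [golProg_closure _ _ _ hbc] at hz1
  rw [golProg_closure _ _ _ hcv] at hz2
  refine ⟨closure_mono hbs ?_, closure_mono hcs ?_⟩
  · rw [golProg_closure _ _ _ hb]
    intro d hd hzd
    exact (hz1 d hd hzd).of_dvd (Nat.gcd_dvd_gcd_mul_right_right _ _ _)
  · rw [golProg_closure _ _ _ hc]
    intro d hd hzd
    have : Nat.gcd d c = 1 := by
      by_contra hne
      obtain ⟨p, hp, hpd⟩ := Nat.exists_prime_and_dvd hne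
      have hpd1 := hpd.trans (Nat.gcd_dvd_left _ _)
      have hpc := hpd.trans (Nat.gcd_dvd_right _ _)
      have hzp : Nat.Coprime z (p ^ v) := (Nat.Coprime.of_dvd_right hpd1 hzd).pow_right _
      have hpv : 1 ≤ p ^ v := Nat.pow_pos hp.pos
      have hpcv : p ^ v ∣ c ^ v := pow_dvd_pow_of_dvd hpc v
      have e1 := hz1 _ hpv hzp
      have e2 := hz2 _ hpv hzp
      rw [Nat.gcd_eq_left (hpcv.mul_left b)] at e1
      rw [Nat.gcd_eq_left hpcv] at e2
      have e3 : 1 ≡ v [MOD p ^ v] := e1.symm.trans e2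
      have e4 := (Nat.modEq_iff_dvd' (by omega)).1 e3
      have e5 := Nat.le_of_dvd (by omega) e4
      have e6 : v < p ^ v := Nat.lt_pow_self hp.one_lt
      omega
    rw [this]
    exact Nat.modEq_one

theorem golSub_contra (x y : ℕ+) (hx : x ≠ 1) (hy : y ≠ 1) : ¬ golSub x 1 y := by
  intro H
  have hx1 : (x : ℕ) ≠ 1 := fun h => hx (PNat.coe_eq_one_iff.1 h)
  have hy1 : (y : ℕ) ≠ 1 := fun h => hy (PNat.coe_eq_one_iff.1 h)
  obtain ⟨p, hp, hpx⟩ := Nat.exists_prime_and_dvd hx1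
  obtain ⟨r, n, hn, hpr, hrn, hry⟩ : ∃ r n : ℕ, 1 ≤ n ∧ ¬ p ∣ r ∧ ¬ (1 ≡ r [MOD p ^ n]) ∧
      (p ∣ (y : ℕ) ∨ r = y) := by
    by_cases hpy : p ∣ (y : ℕ)
    · refine ⟨1 + p, 2, by norm_num, ?_, ?_, Or.inl hpy⟩
      · intro h
        have := (Nat.dvd_add_left (dvd_refl p)).1 h
        exact hp.one_lt.ne' (Nat.dvd_one.1 this)
      · intro h
        have := (Nat.modEq_iff_dvd' (by omega)).1 h
        have := Nat.le_of_dvd (by have := hp.pos; omega) this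
        have := hp.two_le
        simp only [Nat.add_sub_cancel_left] at *
        nlinarith
    · have hyp := y.pos
      refine ⟨y, y, y.pos, hpy, ?_, Or.inr rfl⟩
      intro h
      have e4 := (Nat.modEq_iff_dvd' (by omega)).1 h
      have e5 := Nat.le_of_dvd (by omega) e4
      have e6 : (y : ℕ) < p ^ (y : ℕ) := Nat.lt_pow_self hp.one_lt
      omega
  have hpn : 1 ≤ p ^ n := Nat.pow_pos hp.pos
  obtain ⟨U', V', hU', hV', hxU, hyV, hs⟩ := H Set.univ (golProg 1 (p ^ n)) (@isOpen_univ _ golombTopology)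
    (golProg_open _ _ hpn (by simp)) trivial (golProg_self _ _)
  obtain ⟨b, hb, hxb, hbs⟩ := golProg_nhds U' hU' x hxU
  obtain ⟨c, hc, hyc, hcs⟩ := golProg_nhds V' hV' y hyV
  obtain ⟨j, c', hpc', hcc⟩ := Nat.exists_eq_pow_mul_and_not_dvd (n := c) (by omega) p hp.ne_one
  have hpb : ¬ p ∣ b := fun h => by
    have := Nat.dvd_gcd hpx h
    rw [hxb] at this
    exact hp.one_lt.ne' (Nat.dvd_one.1 this)
  have hco : Nat.Coprime (p ^ (n + j)) (b * c') :=
    Nat.Coprime.pow_left _ ((hp.coprime_iff_not_dvd.2 hpb).mul_right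
      (hp.coprime_iff_not_dvd.2 hpc'))
  obtain ⟨z, hz1, hz2⟩ := Nat.chineseRemainder hco r 0
  have hz2 : b * c' ∣ z := (Nat.modEq_zero_iff_dvd).1 hz2
  have hpz : ¬ p ∣ z := by
    intro h
    exact hpr (((hz1.of_dvd (dvd_pow_self p (by omega))).dvd_iff (dvd_refl p)).1 h)
  have hz0 : 0 < z := Nat.pos_of_ne_zero fun h => hpz (h ▸ dvd_zero p)
  obtain ⟨zp, rfl⟩ : ∃ zp : ℕ+, (zp : ℕ) = z := ⟨⟨z, hz0⟩, rfl⟩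
  have key := hs (a := zp) ⟨closure_mono hbs ?_, closure_mono hcs ?_⟩
  · have k2 := key.2
    rw [golProg_closure _ _ _ hpn] at k2
    have := k2 (p ^ n) hpn (((hp.coprime_iff_not_dvd.2 hpz).symm).pow_right n)
    rw [Nat.gcd_self] at this
    have h3 : (zp : ℕ) ≡ 1 [MOD p ^ n] := this
    exact hrn (h3.symm.trans (hz1.of_dvd (pow_dvd_pow p (by omega))))
  · rw [golProg_closure _ _ _ hb]
    intro d hd hzd
    have : Nat.gcd d b = 1 :=
      (Nat.Coprime.of_dvd_left ((Dvd.intro _ rfl).trans hz2) hzd).symm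
    rw [this]
    exact Nat.modEq_one
  · rw [golProg_closure _ _ _ hc]
    intro d hd hzd
    have hdc : Nat.Coprime d c' :=
      (Nat.Coprime.of_dvd_left ((Dvd.intro_left _ rfl).trans hz2) hzd).symm
    have hg : Nat.gcd d c ∣ p ^ j := by
      rw [hcc, Nat.Coprime.gcd_mul_right_cancel_right _ hdc.symm]
      exact Nat.gcd_dvd_right _ _
    refine Nat.ModEq.of_dvd hg ?_
    rcases hry with hpy | rfl
    · have : j = 0 := by
        by_contra hj
        have h1 : p ∣ c := hcc ▸ (dvd_pow_self p hj).mul_right c'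
        have := Nat.dvd_gcd hpy h1
        rw [hyc] at this
        exact hp.one_lt.ne' (Nat.dvd_one.1 this)
      rw [this, pow_zero]
      exact Nat.modEq_one
    · exact hz1.of_dvd (pow_dvd_pow p (by omega))

theorem golomb_homeo_fixes_one (h : ℕ+ ≃ₜ ℕ+) : h 1 = 1 := by
  by_contra hne
  have hw : h.symm 1 ≠ 1 := fun e => hne (by rw [← e]; simpa using e.symm)
  have H := golSub_map h _ _ _ (golSub_one _ hw)
  rw [h.apply_symm_apply] at H
  refine golSub_contra _ _ hne ?_ H
  intro e
  have e2 : (h.symm 1) ^ 2 = h.symm 1 := by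
    have := congrArg h.symm e
    rwa [h.symm_apply_apply] at this
  apply hw
  have e3 := congrArg PNat.val e2
  rw [← PNat.coe_eq_one_iff]
  have hpos := (h.symm 1).pos
  simp only [PNat.val_ofNat, PNat.pow_coe] at e3
  nlinarith
end

section
/- For any prime b and any positive integer a that is not a b-th power of a positive integer, there exist infinitely many primes p ≡ 1 (mod b) such that a^((p−1)/b) ≢ 1 (mod p). -/
open ArithmeticFunction.vonMangoldt in
theorem aux_not_summable (b : ℕ) (hb : b ≠ 0) :
    ¬ Summable (fun n : ℕ => if n.Prime ∧ n ≡ 1 [MOD b] then (1:ℝ)/n else 0) := by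
  intro H
  have : NeZero b := ⟨hb⟩
  have hu : IsUnit (1 : ZMod b) := isUnit_one
  obtain ⟨C, hC⟩ := LSeries_residueClass_lower_bound hu
  have hnp := summable_residueClass_non_primes_div (1 : ZMod b)
  have hs := H.add hnp
  have key : Filter.Tendsto (fun e : ℝ => ∑' n : ℕ, e * (residueClass (1 : ZMod b) n / (n:ℝ) ^ (1+e)))
      (nhdsWithin 0 (Set.Ioi 0)) (nhds (∑' n : ℕ, (0:ℝ))) := by
    refine tendsto_tsum_of_dominated_convergence hs ?_ ?_
    · intro n
      have : Filter.Tendsto (fun e : ℝ => e * (residueClass (1 : ZMod b) n / (n:ℝ) ^ (1+e)))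
        (nhds 0) (nhds (0 * (residueClass (1 : ZMod b) n / (n:ℝ) ^ (1+(0:ℝ))))) := by
        rcases Nat.eq_zero_or_pos n with rfl | hn
        · have : residueClass (1 : ZMod b) 0 = 0 := by
            simp [residueClass]
          simp [this]
        · have hn' : (0:ℝ) < n := by exact_mod_cast hn
          refine Filter.Tendsto.mul Filter.tendsto_id ?_
          refine Filter.Tendsto.div tendsto_const_nhds ?_ (by positivity)
          exact ((Real.continuous_const_rpow hn'.ne').comp (by fun_prop : Continuous fun e : ℝ => 1 + e)).tendsto 0
      rw [zero_mul] at this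
      exact this.mono_left nhdsWithin_le_nhds
    · have h1 : ∀ᶠ e : ℝ in nhdsWithin 0 (Set.Ioi 0), e ≤ 1 :=
        nhdsWithin_le_nhds (Iic_mem_nhds (by norm_num))
      filter_upwards [self_mem_nhdsWithin, h1] with e he he1 n
      have he : 0 < e := he
      have h0 := residueClass_nonneg (1 : ZMod b) n
      rw [Real.norm_of_nonneg (by positivity)]
      rcases Nat.eq_zero_or_pos n with rfl | hn
      · have : residueClass (1 : ZMod b) 0 = 0 := by
          simp [residueClass]
        simp [this]
      have hn' : (0:ℝ) < n := by exact_mod_cast hn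
      have hn1 : (1:ℝ) ≤ n := by exact_mod_cast hn
      rw [Real.rpow_add hn', Real.rpow_one]
      have hp1 : 1 ≤ (n:ℝ) ^ e := Real.one_le_rpow hn1 he.le
      by_cases hp : n.Prime
      · by_cases hm : n ≡ 1 [MOD b]
        · have hr : residueClass (1 : ZMod b) n ≤ Real.log n :=
            (residueClass_le _ n).trans ArithmeticFunction.vonMangoldt_le_log
          have hl : e * Real.log n ≤ (n:ℝ) ^ e := by
            have := Real.log_le_sub_one_of_pos (show 0 < (n:ℝ)^e by positivity)
            rw [Real.log_rpow hn'] at this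
            linarith
          simp only [hp, hm, and_self, if_true, zero_div, add_zero]
          rw [← mul_div_assoc, div_le_div_iff₀ (by positivity) hn']
          nlinarith [mul_le_mul_of_nonneg_left hr he.le]
        · have : residueClass (1 : ZMod b) n = 0 := by
            rw [residueClass, Set.indicator_of_notMem]
            intro h
            apply hm
            rw [← ZMod.natCast_eq_natCast_iff]
            simpa using h
          simp [this, hp, hm]
      · simp only [hp, false_and, if_false, zero_add]
        calc e * (residueClass (1 : ZMod b) n / (n * (n:ℝ)^e)) ≤ 1 * (residueClass (1 : ZMod b) n / (n * 1)) := by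
              gcongr
          _ = _ := by simp
  rw [tsum_zero] at key
  have lo : Filter.Tendsto (fun e : ℝ => (b.totient : ℝ)⁻¹ - C * e) (nhdsWithin 0 (Set.Ioi 0)) (nhds ((b.totient : ℝ)⁻¹ - C * 0)) :=
    ((by fun_prop : Continuous fun e : ℝ => (b.totient : ℝ)⁻¹ - C * e).tendsto 0).mono_left nhdsWithin_le_nhds
  have hle := le_of_tendsto_of_tendsto lo key (by
    have h1 : ∀ᶠ e : ℝ in nhdsWithin 0 (Set.Ioi 0), e ≤ 1 :=
        nhdsWithin_le_nhds (Iic_mem_nhds (by norm_num))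
    filter_upwards [self_mem_nhdsWithin, h1] with e he he1
    have he : 0 < e := he
    have := hC (x := 1 + e) ⟨by linarith, by linarith⟩
    rw [tsum_mul_left]
    have h2 := mul_le_mul_of_nonneg_left this he.le
    rw [show 1 + e - 1 = e by ring, mul_sub, mul_div_cancel₀ _ he.ne'] at h2
    linarith)
  have : (0:ℝ) < (b.totient : ℝ)⁻¹ := by
    have := Nat.totient_pos.mpr (Nat.pos_of_ne_zero hb)
    positivity
  linarith

open NumberField in
theorem aux_counting {K : Type} [Field K] [NumberField K] (M : ℕ) (hM : M ≠ 0) (R : ℕ → Prop)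
    [DecidablePred R]
    (P Q : ℕ → Ideal (𝓞 K))
    (hP : ∀ p, p.Prime → ¬ p ∣ M → Ideal.absNorm (P p) = p)
    (hQ : ∀ p, p.Prime → ¬ p ∣ M → R p → Ideal.absNorm (Q p) = p)
    (hPQ : ∀ p, p.Prime → ¬ p ∣ M → R p → Q p ≠ P p) :
    Summable (fun n : ℕ => if n.Prime ∧ ¬ n ∣ M ∧ R n then (1:ℝ)/n else 0) := by
  classical
  have hprime : ∀ (I : Ideal (𝓞 K)) (p : ℕ), p.Prime → Ideal.absNorm I = p → Prime I := by
    intro I p hp h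
    have : I.IsPrime := Ideal.isPrime_of_irreducible_absNorm (by rw [h]; exact hp)
    refine Ideal.prime_of_isPrime ?_ this
    rintro rfl
    simp at h
    exact hp.ne_zero h.symm
  let F : ℕ → Ideal (𝓞 K) := fun n => (n.primeFactorsList.map P).prod
  have hF : ∀ n, n ≠ 0 → n.Coprime M → Ideal.absNorm (F n) = n := by
    intro n hn hc
    simp only [F, map_list_prod, List.map_map]
    conv_rhs => rw [← Nat.prod_primeFactorsList hn]
    congr 1
    conv_rhs => rw [← List.map_id n.primeFactorsList]
    refine List.map_congr_left ?_
    intro p hp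
    have hpp := Nat.prime_of_mem_primeFactorsList hp
    refine hP p hpp ?_
    intro h
    exact Nat.not_coprime_of_dvd_of_dvd hpp.one_lt (Nat.dvd_of_mem_primeFactorsList hp) h hc
  have hdvd : ∀ n q, n ≠ 0 → n.Coprime M → q.Prime → ¬ q ∣ M → R q → ¬ Q q ∣ F n := by
    intro n q hn hc hq hqM hR h
    have hqp := hprime _ _ hq (hQ q hq hqM hR)
    obtain ⟨I, hI, hd⟩ := (hqp.dvd_prod_iff).1 h
    obtain ⟨p, hp, rfl⟩ := List.mem_map.1 hI
    have hpp := Nat.prime_of_mem_primeFactorsList hp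
    have hpM : ¬ p ∣ M := fun h => Nat.not_coprime_of_dvd_of_dvd hpp.one_lt (Nat.dvd_of_mem_primeFactorsList hp) h hc
    have hpI := hprime _ _ hpp (hP p hpp hpM)
    have heq : Q q = P p := associated_iff_eq.1 ((hqp.dvd_prime_iff_associated hpI).1 hd)
    have : q = p := by
      rw [← hQ q hq hqM hR, heq, hP p hpp hpM]
    subst this
    exact hPQ q hq hqM hR heq
  -- bound on number of ideals
  obtain ⟨C, hC⟩ : ∃ C : ℝ, ∀ᶠ s : ℝ in Filter.atTop,
      (Nat.card {I : Ideal (𝓞 K) // Ideal.absNorm I ≤ s} : ℝ) ≤ C * s := by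
    obtain ⟨L, h⟩ : ∃ L : ℝ, Filter.Tendsto
        (fun s : ℝ => (Nat.card {I : Ideal (𝓞 K) // Ideal.absNorm I ≤ s} : ℝ) / s)
        Filter.atTop (nhds L) := ⟨_, Ideal.tendsto_norm_le_div_atTop K⟩
    refine ⟨L + 1, ?_⟩
    · filter_upwards [h.eventually (Iic_mem_nhds (lt_add_one _)), Filter.eventually_gt_atTop 0] with s hs h0
      exact (div_le_iff₀ h0).1 hs
  refine summable_of_sum_le (c := C * M) (fun n => by positivity) ?_
  intro u
  rw [← Finset.sum_filter]
  set T := u.filter (fun n => n.Prime ∧ ¬ n ∣ M ∧ R n) with hT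
  have hTp : ∀ p ∈ T, p.Prime ∧ ¬ p ∣ M ∧ R p := fun p hp => (Finset.mem_filter.1 hp).2
  set D := ∏ p ∈ T, p with hD
  have hD0 : D ≠ 0 := Finset.prod_ne_zero_iff.2 fun p hp => (hTp p hp).1.ne_zero
  have hMD : 0 < M * D := Nat.pos_of_ne_zero (mul_ne_zero hM hD0)
  obtain ⟨s0, hs0⟩ := Filter.eventually_atTop.1 hC
  obtain ⟨t, ht⟩ := exists_nat_ge (max s0 1)
  have ht0 : 0 < t := by
    have : (1:ℝ) ≤ t := (le_max_right _ _).trans ht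
    exact_mod_cast this
  have hx : s0 ≤ ((t * (M * D) : ℕ) : ℝ) := by
    refine (le_max_left _ _).trans (ht.trans ?_)
    exact_mod_cast Nat.le_mul_of_pos_right t hMD
  have hcard := hs0 _ hx
  have hfin : Finite {I : Ideal (𝓞 K) // (Ideal.absNorm I : ℝ) ≤ ((t * (M * D) : ℕ) : ℝ)} := by
    have := Ideal.finite_setOfPred_absNorm_le (S := 𝓞 K) (t * (M * D))
    refine Set.Finite.to_subtype (s := {I : Ideal (𝓞 K) | (Ideal.absNorm I : ℝ) ≤ ((t * (M * D) : ℕ) : ℝ)}) ?_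
    simpa only [Nat.cast_le] using this
  let A : Finset (Σ _ : ℕ, ℕ) := T.sigma (fun p => Finset.range (t * (D / p)))
  have hco : ∀ k, (1 + k * M).Coprime M := by
    intro k; simp
  have hAcard : A.card ≤ Nat.card {I : Ideal (𝓞 K) // (Ideal.absNorm I : ℝ) ≤ ((t * (M * D) : ℕ) : ℝ)} := by
    have hnorm : ∀ y : A, Ideal.absNorm (F (1 + y.1.2 * M) * Q y.1.1) = (1 + y.1.2 * M) * y.1.1 := by
      rintro ⟨⟨p, k⟩, hy⟩
      obtain ⟨hp, hk⟩ := Finset.mem_sigma.1 hy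
      obtain ⟨h1, h2, h3⟩ := hTp p hp
      simp only
      rw [map_mul, hF _ (by omega) (hco k), hQ p h1 h2 h3]
    let g : A → {I : Ideal (𝓞 K) // (Ideal.absNorm I : ℝ) ≤ ((t * (M * D) : ℕ) : ℝ)} :=
      fun y => ⟨F (1 + y.1.2 * M) * Q y.1.1, by
        rw [hnorm, Nat.cast_le]
        obtain ⟨⟨p, k⟩, hy⟩ := y
        obtain ⟨hp, hk⟩ := Finset.mem_sigma.1 hy
        have hk' : k < t * (D / p) := Finset.mem_range.1 hk
        have hpD : p ∣ D := Finset.dvd_prod_of_mem _ hp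
        calc (1 + k * M) * p ≤ ((k + 1) * M) * p := by
              gcongr
              have : 1 ≤ M := Nat.pos_of_ne_zero hM
              linarith
          _ ≤ (t * (D / p) * M) * p := by gcongr; omega
          _ = t * (M * (D / p * p)) := by ring
          _ = t * (M * D) := by rw [Nat.div_mul_cancel hpD]⟩
    have hg : Function.Injective g := by
      intro y z hyz
      have hyz' : F (1 + y.1.2 * M) * Q y.1.1 = F (1 + z.1.2 * M) * Q z.1.1 := congrArg Subtype.val hyz
      have hn := congrArg Ideal.absNorm hyz'
      rw [hnorm, hnorm] at hn
      obtain ⟨⟨p, k⟩, hy⟩ := y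
      obtain ⟨⟨q, l⟩, hz⟩ := z
      simp only at hyz' hn
      obtain ⟨hp, -⟩ := Finset.mem_sigma.1 hy
      obtain ⟨hq, -⟩ := Finset.mem_sigma.1 hz
      obtain ⟨h1, h2, h3⟩ := hTp p hp
      obtain ⟨h1', h2', h3'⟩ := hTp q hq
      have hQp := hprime _ _ h1 (hQ p h1 h2 h3)
      have hQq := hprime _ _ h1' (hQ q h1' h2' h3')
      have hd : Q p ∣ F (1 + l * M) * Q q := hyz' ▸ Dvd.intro_left _ rfl
      have hd2 := (hQp.dvd_or_dvd hd).resolve_left (hdvd _ _ (by omega) (hco l) h1 h2 h3)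
      have heq : Q p = Q q := associated_iff_eq.1 ((hQp.dvd_prime_iff_associated hQq).1 hd2)
      have hpq : p = q := by
        rw [← hQ p h1 h2 h3, heq, hQ q h1' h2' h3']
      subst hpq
      have := Nat.eq_of_mul_eq_mul_right h1.pos hn
      have : k = l := Nat.eq_of_mul_eq_mul_right (Nat.pos_of_ne_zero hM) (by omega)
      subst this
      rfl
    simpa using Nat.card_le_card_of_injective g hg
  have hA2 : (A.card : ℝ) = (t * D : ℝ) * ∑ p ∈ T, (1:ℝ)/p := by
    simp only [A, Finset.card_sigma, Finset.card_range, Nat.cast_sum, Finset.mul_sum]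
    refine Finset.sum_congr rfl fun p hp => ?_
    have hpD : p ∣ D := Finset.dvd_prod_of_mem _ hp
    have hp0 : (p:ℝ) ≠ 0 := by exact_mod_cast (hTp p hp).1.ne_zero
    rw [Nat.cast_mul, Nat.cast_div hpD hp0]
    ring
  have hfinal : (t * D : ℝ) * ∑ p ∈ T, (1:ℝ)/p ≤ (t * D : ℝ) * (C * M) := by
    rw [← hA2]
    refine (Nat.cast_le.2 hAcard).trans (hcard.trans (le_of_eq ?_))
    push_cast
    ring
  refine le_of_mul_le_mul_left hfinal ?_
  have : 0 < D := Nat.pos_of_ne_zero hD0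
  positivity

theorem aux_root_not_one (p b a : ℕ) [Fact p.Prime] (hb : b.Prime) (ha : ¬ p ∣ a)
    (h : ¬ p ≡ 1 [MOD b]) : ∃ r : ZMod p, r ^ b = (a : ZMod p) := by
  have ha0 : (a : ZMod p) ≠ 0 := by rwa [Ne, ZMod.natCast_eq_zero_iff]
  have hp : p.Prime := Fact.out
  have hc : (Nat.card (ZMod p)ˣ).Coprime b := by
    rw [Nat.card_eq_fintype_card, ZMod.card_units_eq_totient, Nat.totient_prime hp]
    refine Nat.Coprime.symm ((Nat.Prime.coprime_iff_not_dvd hb).2 fun hd => h ?_)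
    exact ((Nat.modEq_iff_dvd' hp.one_lt.le).2 hd).symm
  refine ⟨((powCoprime hc).symm (Units.mk0 _ ha0) : (ZMod p)ˣ), ?_⟩
  have := (powCoprime hc).apply_symm_apply (Units.mk0 _ ha0)
  rw [powCoprime_apply] at this
  have h2 := congrArg Units.val this
  simpa using h2

theorem aux_root_one (p b a : ℕ) [Fact p.Prime] (hb : b.Prime) (ha : ¬ p ∣ a)
    (h : p ≡ 1 [MOD b]) (hres : a ^ ((p - 1) / b) ≡ 1 [MOD p]) :
    ∃ r r' : ZMod p, r ≠ r' ∧ r ^ b = (a : ZMod p) ∧ r' ^ b = (a : ZMod p) := by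
  have ha0 : (a : ZMod p) ≠ 0 := by rwa [Ne, ZMod.natCast_eq_zero_iff]
  have hp : p.Prime := Fact.out
  have hd : b ∣ p - 1 := (Nat.modEq_iff_dvd' hp.one_lt.le).1 h.symm
  obtain ⟨m, hm⟩ := hd
  have hm1 : (p - 1) / b = m := by rw [hm, Nat.mul_div_cancel_left _ hb.pos]
  rw [hm1] at hres
  have hp1 : 0 < p - 1 := Nat.sub_pos_of_lt hp.one_lt
  have hm0 : 0 < m := by
    rcases Nat.eq_zero_or_pos m with rfl | h
    · simp at hm; omega
    · exact h
  obtain ⟨g, hg⟩ := IsCyclic.exists_generator (α := (ZMod p)ˣ)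
  have hord : orderOf g = p - 1 := by
    rw [orderOf_eq_card_of_forall_mem_zpowers hg, Nat.card_eq_fintype_card,
      ZMod.card_units_eq_totient, Nat.totient_prime hp]
  set u : (ZMod p)ˣ := Units.mk0 _ ha0 with hu
  obtain ⟨k, hk⟩ := (mem_powers_iff_mem_zpowers.2 (hg u))
  simp only at hk
  have hum : u ^ m = 1 := by
    ext
    have := (ZMod.natCast_eq_natCast_iff _ _ _).2 hres
    simpa [hu] using this
  rw [← hk, ← pow_mul] at hum
  have hdv := orderOf_dvd_of_pow_eq_one hum
  rw [hord, hm] at hdv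
  obtain ⟨j, rfl⟩ := Nat.dvd_of_mul_dvd_mul_right hm0 hdv
  have hr : (g ^ j) ^ b = u := by rw [← hk, ← pow_mul, mul_comm]
  have hz : (g ^ m) ^ b = 1 := by
    rw [← pow_mul, mul_comm, ← hm, ← hord, pow_orderOf_eq_one]
  have hz1 : g ^ m ≠ 1 := by
    intro h
    have := Nat.le_of_dvd hm0 (orderOf_dvd_of_pow_eq_one h)
    rw [hord, hm] at this
    nlinarith [hb.two_le]
  refine ⟨((g ^ j : (ZMod p)ˣ) : ZMod p), ((g ^ j * g ^ m : (ZMod p)ˣ) : ZMod p), ?_, ?_, ?_⟩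
  · intro h
    have := Units.ext h
    exact hz1 (by simpa using this.symm)
  · have := congrArg Units.val hr
    simpa [hu] using this
  · have : (g ^ j * g ^ m) ^ b = u := by rw [mul_pow, hr, hz, mul_one]
    have := congrArg Units.val this
    simpa [hu] using this

theorem aux_rat (b : ℕ) (hb : b.Prime)
    (a : ℕ) (ha : 1 ≤ a) (hpow : ¬ ∃ x : ℕ, 1 ≤ x ∧ x ^ b = a) (x : ℚ) : x ^ b ≠ (a : ℚ) := by
  intro h
  have hi : IsIntegral ℤ x := by
    refine IsIntegral.of_pow hb.pos ?_
    rw [h]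
    exact_mod_cast isIntegral_algebraMap (R := ℤ) (A := ℚ) (x := (a : ℤ))
  obtain ⟨z, rfl⟩ := IsIntegrallyClosed.isIntegral_iff.1 hi
  have hz : z ^ b = (a : ℤ) := by
    have : ((z ^ b : ℤ) : ℚ) = ((a : ℤ) : ℚ) := by simpa using h
    exact_mod_cast this
  have hn : z.natAbs ^ b = a := by
    have := congrArg Int.natAbs hz
    simpa [Int.natAbs_pow] using this
  refine hpow ⟨z.natAbs, ?_, hn⟩
  rcases Nat.eq_zero_or_pos z.natAbs with h0 | h0
  · rw [h0, zero_pow hb.ne_zero] at hn; omega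
  · exact h0

section
open NumberField Polynomial

theorem aux_exponent {K : Type} [Field K] [NumberField K] (θ : 𝓞 K) (B : PowerBasis ℚ K)
    (hB : B.gen = (θ : K)) : RingOfIntegers.exponent θ ≠ 0 := by
  have hint : IsIntegral ℤ B.gen := hB ▸ θ.isIntegral_coe
  have hdi : IsIntegral ℤ (Algebra.discr ℚ B.basis) := Algebra.discr_isIntegral ℚ (fun i => by
    rw [B.basis_eq_pow]; exact hint.pow _)
  obtain ⟨d, hd⟩ := IsIntegrallyClosed.isIntegral_iff.1 hdi
  have hd0 : d ≠ 0 := by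
    rintro rfl
    have := Algebra.discr_not_zero_of_basis ℚ B.basis
    exact this (by rw [← hd]; simp)
  have hmem : ∀ z : 𝓞 K, d • z ∈ Algebra.adjoin ℤ {θ} := by
    intro z
    have h := Algebra.discr_mul_isIntegral_mem_adjoin ℚ hint z.isIntegral_coe
    rw [← hd, hB] at h
    have e : Algebra.adjoin ℤ {(θ : K)} = (Algebra.adjoin ℤ {θ}).map (IsScalarTower.toAlgHom ℤ (𝓞 K) K) := by
      rw [AlgHom.map_adjoin]; simp
    rw [e] at h
    obtain ⟨y, hy, hyz⟩ := h
    have : y = d • z := by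
      apply RingOfIntegers.coe_injective
      have : algebraMap (𝓞 K) K y = (algebraMap ℤ ℚ d) • algebraMap (𝓞 K) K z := hyz
      rw [this, algebraMap_smul]
      simp
    exact this ▸ hy
  rw [RingOfIntegers.exponent_eq_sInf]
  refine (Nat.sInf_mem (s := {d : ℕ | 0 < d ∧ (d : 𝓞 K) ∈ conductor ℤ θ}) ⟨d.natAbs, Int.natAbs_pos.2 hd0, ?_⟩).1.ne'
  rw [mem_conductor_iff]
  intro z
  have h2 : ((d.natAbs : 𝓞 K)) = ((d.natAbs : ℤ) : 𝓞 K) := by simp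
  rw [h2]
  rcases Int.natAbs_eq d with h | h
  · rw [← h]; simpa using hmem z
  · have h3 : ((d.natAbs : ℤ)) = -d := by omega
    rw [h3]
    simpa using neg_mem (hmem z)

theorem aux_norm {K : Type} [Field K] [NumberField K] (θ : 𝓞 K) (b a p : ℕ) [Fact p.Prime] 
    (hmin : minpoly ℤ θ = X ^ b - C (a : ℤ)) (hp : ¬ p ∣ RingOfIntegers.exponent θ) (r : ℤ)
    (hr : (r : ZMod p) ^ b = (a : ZMod p)) :
    Ideal.absNorm (Ideal.span {(p : 𝓞 K), θ - (r : 𝓞 K)}) = p := by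
  have hmap : (X - C r : ℤ[X]).map (Int.castRingHom (ZMod p)) = X - C (r : ZMod p) := by simp
  have hQ : (X - C r : ℤ[X]).map (Int.castRingHom (ZMod p)) ∈ RingOfIntegers.monicFactorsMod θ p := by
    rw [Multiset.mem_toFinset, Polynomial.mem_normalizedFactors_iff
      (Polynomial.map_monic_ne_zero (minpoly.monic θ.isIntegral)), hmap]
    refine ⟨irreducible_X_sub_C _, monic_X_sub_C _, ?_⟩
    rw [dvd_iff_isRoot, hmin]
    simp [hr]
  have e := RingOfIntegers.ZModXQuotSpanEquivQuotSpanPair hp hQ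
  have hae : aeval θ (X - C r : ℤ[X]) = θ - (r : 𝓞 K) := by simp
  rw [hae, hmap] at e
  have e2 := (quotientSpanXSubCAlgEquiv (r : ZMod p))
  rw [Ideal.absNorm_apply, Submodule.cardQuot_apply]
  rw [← Nat.card_congr e.toEquiv, Nat.card_congr e2.toEquiv, Nat.card_zmod]

theorem aux_ne {K : Type} [Field K] [NumberField K] (θ : 𝓞 K) (p : ℕ) [Fact p.Prime] (r r' : ℤ)
    (hr : (r : ZMod p) ≠ (r' : ZMod p))
    (h1 : Ideal.absNorm (Ideal.span {(p : 𝓞 K), θ - (r : 𝓞 K)}) = p) :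
    Ideal.span {(p : 𝓞 K), θ - (r : 𝓞 K)} ≠ Ideal.span {(p : 𝓞 K), θ - (r' : 𝓞 K)} := by
  intro h
  have hp : p.Prime := Fact.out
  have m1 : θ - (r : 𝓞 K) ∈ Ideal.span {(p : 𝓞 K), θ - (r : 𝓞 K)} := Ideal.subset_span (by simp)
  have m2 : θ - (r' : 𝓞 K) ∈ Ideal.span {(p : 𝓞 K), θ - (r : 𝓞 K)} := h ▸ Ideal.subset_span (by simp)
  have m0 : (p : 𝓞 K) ∈ Ideal.span {(p : 𝓞 K), θ - (r : 𝓞 K)} := Ideal.subset_span (by simp)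
  have m3 := Ideal.sub_mem _ m1 m2
  have hcop : IsCoprime (p : ℤ) (r' - r) := by
    rw [Prime.coprime_iff_not_dvd (Nat.prime_iff_prime_int.1 hp)]
    intro hd
    exact hr ((ZMod.intCast_eq_intCast_iff_dvd_sub _ _ _).2 hd)
  obtain ⟨x, y, hxy⟩ := hcop
  have : (1 : 𝓞 K) ∈ Ideal.span {(p : 𝓞 K), θ - (r : 𝓞 K)} := by
    have e : (1 : 𝓞 K) = x * p + y * ((θ - (r : 𝓞 K)) - (θ - (r' : 𝓞 K))) := by
      have := congrArg (Int.cast : ℤ → 𝓞 K) hxy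
      push_cast at this
      rw [← this]; ring
    rw [e]
    exact Ideal.add_mem _ (Ideal.mul_mem_left _ _ m0) (Ideal.mul_mem_left _ _ m3)
  rw [(Ideal.eq_top_iff_one _).2 this, Ideal.absNorm_top] at h1
  exact hp.one_lt.ne h1

theorem aux_field (b : ℕ) (hb : b.Prime)
    (a : ℕ) (hx : ∀ x : ℚ, x ^ b ≠ (a : ℚ)) : ∃ (K : Type) (_ : Field K) (_ : NumberField K) (θ : 𝓞 K),
      minpoly ℤ θ = X ^ b - C (a : ℤ) ∧ RingOfIntegers.exponent θ ≠ 0 := by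
  have hirr : Irreducible (X ^ b - C (a : ℚ)) := X_pow_sub_C_irreducible_of_prime hb hx
  have hmon : (X ^ b - C (a : ℚ)).Monic := monic_X_pow_sub_C _ hb.ne_zero
  have : Fact (Irreducible (X ^ b - C (a : ℚ))) := ⟨hirr⟩
  let K := AdjoinRoot (X ^ b - C (a : ℚ))
  let B : PowerBasis ℚ K := AdjoinRoot.powerBasis hirr.ne_zero
  have : FiniteDimensional ℚ K := B.finite
  have : CharZero K := algebraRat.charZero K
  have : NumberField K := ⟨⟩
  have hroot : (AdjoinRoot.root (X ^ b - C (a : ℚ)) : K) ^ b = (a : K) := by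
    have := AdjoinRoot.eval₂_root (X ^ b - C (a : ℚ))
    simpa [sub_eq_zero] using this
  have hint : IsIntegral ℤ (AdjoinRoot.root (X ^ b - C (a : ℚ)) : K) := by
    refine IsIntegral.of_pow hb.pos ?_
    rw [hroot]
    exact_mod_cast isIntegral_algebraMap (R := ℤ) (A := K) (x := (a : ℤ))
  let θ : 𝓞 K := ⟨AdjoinRoot.root (X ^ b - C (a : ℚ)), hint⟩
  refine ⟨K, inferInstance, inferInstance, θ, ?_, aux_exponent θ B ?_⟩
  · have h1 := minpoly.isIntegrallyClosed_eq_field_fractions ℚ K θ.isIntegral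
    have h2 : minpoly ℚ (algebraMap (𝓞 K) K θ) = X ^ b - C (a : ℚ) := by
      have := AdjoinRoot.minpoly_root hirr.ne_zero
      rw [hmon.leadingCoeff, inv_one, C_1, mul_one] at this
      exact this
    apply Polynomial.map_injective (algebraMap ℤ ℚ) (FaithfulSMul.algebraMap_injective ℤ ℚ)
    rw [← h1, h2]
    simp
  · exact AdjoinRoot.powerBasis_gen hirr.ne_zero

theorem aux_summable (b : ℕ) (hb : b.Prime)
    (a : ℕ) (ha : 1 ≤ a) (hpow : ¬ ∃ x : ℕ, 1 ≤ x ∧ x ^ b = a)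
    (hfin : {p : ℕ | p.Prime ∧ p ≡ 1 [MOD b] ∧ ¬ a ^ ((p - 1) / b) ≡ 1 [MOD p]}.Finite) :
    Summable (fun n : ℕ => if n.Prime ∧ n ≡ 1 [MOD b] then (1:ℝ)/n else 0) := by
  obtain ⟨K, _, _, θ, hmin, hexp⟩ := aux_field b hb a (aux_rat b hb a ha hpow)
  set M : ℕ := RingOfIntegers.exponent θ * a * ∏ p ∈ hfin.toFinset, p with hMdef
  have hM : M ≠ 0 := by
    refine mul_ne_zero (mul_ne_zero hexp (by omega)) (Finset.prod_ne_zero_iff.2 fun p hp => ?_)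
    exact ((Set.Finite.mem_toFinset hfin).1 hp).1.ne_zero
  have hgood : ∀ p, p.Prime → ¬ p ∣ M → ¬ p ∣ RingOfIntegers.exponent θ ∧ ¬ p ∣ a ∧
      (p ≡ 1 [MOD b] → a ^ ((p - 1) / b) ≡ 1 [MOD p]) := by
    intro p hp hpM
    refine ⟨fun h => hpM ?_, fun h => hpM ?_, fun h => ?_⟩
    · exact (h.mul_right _).mul_right _
    · exact (h.mul_left _).mul_right _
    · by_contra hn
      have hmem : p ∈ hfin.toFinset := (Set.Finite.mem_toFinset hfin).2 ⟨hp, h, hn⟩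
      exact hpM ((Finset.dvd_prod_of_mem (fun p => p) hmem).mul_left _)
  have hex : ∀ p, ∃ rr : ℤ × ℤ, p.Prime → ¬ p ∣ M → ((rr.1 : ZMod p) ^ b = (a : ZMod p) ∧
      (p ≡ 1 [MOD b] → (rr.2 : ZMod p) ^ b = (a : ZMod p) ∧
        (rr.2 : ZMod p) ≠ (rr.1 : ZMod p))) := by
    intro p
    by_cases hp : p.Prime
    swap
    · exact ⟨(0, 0), fun h => absurd h hp⟩
    by_cases hpM : p ∣ M
    · exact ⟨(0, 0), fun _ h => absurd hpM h⟩
    obtain ⟨h1, h2, h3⟩ := hgood p hp hpM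
    have : Fact p.Prime := ⟨hp⟩
    by_cases hm : p ≡ 1 [MOD b]
    · obtain ⟨r, r', hne, e, e'⟩ := aux_root_one p b a hb h2 hm (h3 hm)
      obtain ⟨x, rfl⟩ := ZMod.intCast_surjective r
      obtain ⟨y, rfl⟩ := ZMod.intCast_surjective r'
      exact ⟨(x, y), fun _ _ => ⟨e, fun _ => ⟨e', hne.symm⟩⟩⟩
    · obtain ⟨r, e⟩ := aux_root_not_one p b a hb h2 hm
      obtain ⟨x, rfl⟩ := ZMod.intCast_surjective r
      exact ⟨(x, 0), fun _ _ => ⟨e, fun h => absurd h hm⟩⟩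
  choose rr hrr using hex
  have hP : ∀ p, p.Prime → ¬ p ∣ M →
      Ideal.absNorm (Ideal.span {(p : 𝓞 K), θ - ((rr p).1 : 𝓞 K)}) = p := by
    intro p hp hpM
    have : Fact p.Prime := ⟨hp⟩
    exact aux_norm θ b a p hmin (hgood p hp hpM).1 _ (hrr p hp hpM).1
  have hQ : ∀ p, p.Prime → ¬ p ∣ M → p ≡ 1 [MOD b] →
      Ideal.absNorm (Ideal.span {(p : 𝓞 K), θ - ((rr p).2 : 𝓞 K)}) = p := by
    intro p hp hpM hm
    have : Fact p.Prime := ⟨hp⟩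
    exact aux_norm θ b a p hmin (hgood p hp hpM).1 _ ((hrr p hp hpM).2 hm).1
  have hs := aux_counting M hM (fun p => p ≡ 1 [MOD b]) _ _ hP hQ (by
    intro p hp hpM hm
    have : Fact p.Prime := ⟨hp⟩
    exact aux_ne θ p _ _ ((hrr p hp hpM).2 hm).2 (hQ p hp hpM hm))
  refine (summable_congr_cofinite ?_).1 hs
  have hfd : {n : ℕ | n ∣ M}.Finite := (Set.finite_le_nat M).subset
    fun n hn => Nat.le_of_dvd (Nat.pos_of_ne_zero hM) hn
  filter_upwards [hfd.compl_mem_cofinite] with n hn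
  have hn' : ¬ n ∣ M := hn
  simp [hn']

end

theorem infinitely_many_primes_nonresidue (b : ℕ) (hb : b.Prime)
    (a : ℕ) (ha : 1 ≤ a) (hpow : ¬ ∃ x : ℕ, 1 ≤ x ∧ x ^ b = a) :
    {p : ℕ | p.Prime ∧ p ≡ 1 [MOD b] ∧ ¬ a ^ ((p - 1) / b) ≡ 1 [MOD p]}.Infinite := by
  intro hfin
  exact aux_not_summable b hb.ne_zero (aux_summable b hb a ha hpow hfin)
end
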